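/- (Residue formula for Type I row polynomials.) Assume β·β' ≠ 0; set σ := sign(β·β') ∈ {−1,+1}, r := α/β, r' := α'/β', s := (α+γ)/β, s' := −1−(α'+γ')/β', η := s+s'+1+r'−r, and define the rescaled row polynomials 𝒫_n(X) := β^{−n}·P_n(σ·β·X/β'). Fix X with 0 < X < 1 and n ∈ ℕ, and define f : ℝ → ℝ by f(Z) = Z^{s−r−1}·(1+σ·Z)^{−η}·((Z−X)/(Q(Z)−Q(X)))^{n+1} (real powers of the positive bases Z and 1+σZ for 0 < Z < 1; with Lean's conventions Real.rpow and division-by-zero = 0 this defines f totally). Then the n-th derivative of f has a limit as Z → X within Z ≠ X, namely: Filter.Tendsto (iteratedDeriv n f) (𝓝[≠] X) (𝓝 (X^{s+r·n}·(1+σ·X)^{−n·(r−r')−s−s'}·𝒫_n(X))). -/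

import Mathlib

open Filter Topology

theorem iteratedDeriv_succ_sub_mul {k : ℝ → ℝ} {x : ℝ} (hk : AnalyticAt ℝ k x) (m : ℕ) :
    iteratedDeriv (m + 1) (fun z => (z - x) * k z) x = (m + 1) * iteratedDeriv m k x := by
  have hw : AnalyticAt ℝ (fun z => z - x) x := by fun_prop
  have h0 : deriv (fun z : ℝ => z - x) = fun _ => 1 := by
    ext z; simp
  rw [iteratedDeriv_fun_mul hw.contDiffAt hk.contDiffAt, Finset.sum_eq_single 1]
  · simp
  · intro i _ hi
    rcases i with _ | _ | i
    · simp
    · simp at hi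
    · rw [iteratedDeriv_succ', h0]
      simp [iteratedDeriv_const]
  · simp

theorem AnalyticAt.dslope_self {f : ℝ → ℝ} {x : ℝ} (hf : AnalyticAt ℝ f x) :
    AnalyticAt ℝ (dslope f x) x := by
  obtain ⟨p, hp⟩ := hf
  exact ⟨_, hp.has_fpower_series_dslope_fslope⟩

/-- One step of Lagrange inversion: integration by parts for the residue of
`H u' / u ^ (m + 2)`, where `u = Q - Q x`. -/
theorem iteratedDeriv_succ_mul_deriv_div_dslope_pow {Q H : ℝ → ℝ} {x : ℝ}
    (hQ : AnalyticAt ℝ Q x) (hQ' : deriv Q x ≠ 0) (hH : AnalyticAt ℝ H x) (m : ℕ) :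
    iteratedDeriv (m + 1) (fun z => H z * deriv Q z * (dslope Q x z)⁻¹ ^ (m + 2)) x =
      iteratedDeriv m (fun z => deriv H z * (dslope Q x z)⁻¹ ^ (m + 1)) x := by
  set D := dslope Q x with hD
  have hDa : AnalyticAt ℝ D x := hQ.dslope_self
  have hDx : D x ≠ 0 := by rwa [hD, dslope_same]
  have hI : AnalyticAt ℝ (fun z => (D z)⁻¹) x := hDa.inv hDx
  set Φ : ℝ → ℝ := fun z => H z * (D z)⁻¹ ^ (m + 1) with hΦ
  have hΦa : AnalyticAt ℝ Φ x := hH.mul (hI.pow _)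
  set K : ℝ → ℝ := fun z => deriv H z * (D z)⁻¹ ^ (m + 1) with hK
  have hKa : AnalyticAt ℝ K x := hH.deriv.mul (hI.pow _)
  have hΨa : AnalyticAt ℝ (fun z => K z - deriv Φ z) x := hKa.sub hΦa.deriv
  have hfac : Q = fun z => Q x + (z - x) * D z := by
    ext z
    have := sub_smul_dslope Q x z
    simp only [smul_eq_mul] at this
    rw [hD, this]; ring
  have key : (fun z => ((m : ℝ) + 1) * (H z * deriv Q z * (D z)⁻¹ ^ (m + 2))) =ᶠ[𝓝 x]
      fun z => (m + 1) * Φ z + (z - x) * (K z - deriv Φ z) := by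
    filter_upwards [hDa.eventually_analyticAt, hH.eventually_analyticAt,
      hDa.continuousAt.eventually_ne hDx] with z h1 h2 h3
    have hdD := h1.differentiableAt.hasDerivAt
    have hdH := h2.differentiableAt.hasDerivAt
    have e1 : deriv Q z = D z + (z - x) * deriv D z := by
      rw [hfac]
      have := ((((hasDerivAt_id z).sub_const x).mul hdD).const_add (Q x)).deriv
      simpa using this
    have e2 : deriv Φ z = deriv H z * (D z)⁻¹ ^ (m + 1)
        + H z * ((m + 1 : ℕ) * (D z)⁻¹ ^ m * (-deriv D z / D z ^ 2)) :=
      (hdH.mul ((hdD.inv h3).pow (m + 1))).deriv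
    rw [e1, e2]
    simp only [hΦ, hK, inv_pow]
    push_cast
    field_simp
    ring
  have h2 := key.iteratedDeriv_eq (m + 1)
  have hF : AnalyticAt ℝ (fun z => H z * deriv Q z * (D z)⁻¹ ^ (m + 2)) x :=
    (hH.mul hQ.deriv).mul (hI.pow _)
  have hΦc : AnalyticAt ℝ (fun z => ((m : ℝ) + 1) * Φ z) x := analyticAt_const.mul hΦa
  rw [iteratedDeriv_const_mul _ hF.contDiffAt,
    iteratedDeriv_fun_add hΦc.contDiffAt
      (AnalyticAt.contDiffAt (by fun_prop)),
    iteratedDeriv_const_mul _ hΦa.contDiffAt, iteratedDeriv_succ_sub_mul hΨa,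
    iteratedDeriv_fun_sub hKa.contDiffAt hΦa.deriv.contDiffAt, ← iteratedDeriv_succ'] at h2
  have hm : (m : ℝ) + 1 ≠ 0 := by positivity
  apply mul_left_cancel₀ hm
  rw [h2]; ring

/-- Lagrange inversion: if `T (k + 1) = T k' / Q'` near `x` for all `k`, then `T n x` is the
`n`-th derivative at `x` of `T 0 * Q' / (dslope Q x) ^ (n + 1)`. -/
theorem iteratedDeriv_mul_deriv_div_dslope_pow {Q : ℝ → ℝ} {x : ℝ} {T : ℕ → ℝ → ℝ}
    (hQ : AnalyticAt ℝ Q x) (hQ' : deriv Q x ≠ 0) (hT : ∀ k, AnalyticAt ℝ (T k) x)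
    (hrec : ∀ k, deriv (T k) =ᶠ[𝓝 x] fun z => T (k + 1) z * deriv Q z) (n k : ℕ) :
    iteratedDeriv n (fun z => T k z * deriv Q z * (dslope Q x z)⁻¹ ^ (n + 1)) x =
      T (k + n) x := by
  induction n generalizing k with
  | zero => simp [hQ']
  | succ m ih =>
    rw [iteratedDeriv_succ_mul_deriv_div_dslope_pow hQ hQ' (hT k), ← add_assoc, add_right_comm,
      ← ih (k + 1)]
    apply EventuallyEq.iteratedDeriv_eq
    filter_upwards [hrec k] with z hz
    rw [hz]

theorem Ring.choose_eq_prod_range_div_factorial (a : ℝ) (k : ℕ) :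
    Ring.choose a k = (∏ i ∈ Finset.range k, (a - (i : ℝ))) / (k.factorial : ℝ) := by
  rw [Ring.choose_eq_smul, ← descPochhammer_eval_eq_prod_range, ← Polynomial.aeval_eq_smeval,
    Polynomial.aeval_def, Polynomial.eval₂_eq_eval_map, descPochhammer_map, smul_eq_mul,
    div_eq_inv_mul]

theorem AnalyticAt.rpow_const_of_ne {f : ℝ → ℝ} {x : ℝ} (hf : AnalyticAt ℝ f x) (h : f x ≠ 0)
    (p : ℝ) : AnalyticAt ℝ (fun z => f z ^ p) x :=
  (hf.contDiffAt.rpow_const_of_ne h).analyticAt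

theorem summable_abs_choose_mul_pow (a : ℝ) {x : ℝ} (hx0 : 0 ≤ x) (hx1 : x < 1) :
    Summable fun k : ℕ => |Ring.choose a k| * x ^ k := by
  lift x to NNReal using hx0
  have h : (x : ENNReal) < (binomialSeries ℝ a).radius :=
    lt_of_lt_of_le (by exact_mod_cast hx1) binomialSeries_radius_ge_one
  refine ((binomialSeries ℝ a).summable_norm_mul_pow h).congr fun k => ?_
  simp [binomialSeries]

theorem hasSum_choose_mul_pow (a : ℝ) {x : ℝ} (hx : |x| < 1) :
    HasSum (fun k : ℕ => Ring.choose a k * x ^ k) ((1 + x) ^ a) := by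
  have h := (Real.one_add_rpow_hasFPowerSeriesOnBall_zero (a := a)).hasSum (y := x)
    (by simpa [Metric.mem_eball, edist_dist, Real.dist_eq] using hx)
  simpa [binomialSeries, mul_comm] using h

/-- The termwise antiderivative of `∑ b k * x ^ (k - r - 1)`. -/
noncomputable def logPrimitiveSeries (b : ℕ → ℝ) (r x : ℝ) : ℝ :=
  ∑' k : ℕ, if (k : ℝ) = r then b k * Real.log x else b k * x ^ ((k : ℝ) - r) / ((k : ℝ) - r)

section LogPrimitiveSeries

variable {b : ℕ → ℝ} {r x : ℝ}

/-- Coefficients of the power series part of `logPrimitiveSeries`. -/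
noncomputable def logPrimitiveCoeff (b : ℕ → ℝ) (r : ℝ) (k : ℕ) : ℝ :=
  if (k : ℝ) = r then 0 else b k / ((k : ℝ) - r)

theorem summable_abs_logPrimitiveCoeff_mul_pow (hx0 : 0 ≤ x)
    (h : Summable fun k => |b k| * x ^ k) :
    Summable fun k => |logPrimitiveCoeff b r k| * x ^ k := by
  refine h.of_norm_bounded_eventually_nat ?_
  filter_upwards [eventually_ge_atTop (⌈r⌉₊ + 1)] with k hk
  have hk' : r + 1 ≤ k := (add_le_add_left (Nat.le_ceil r) 1).trans (by exact_mod_cast hk)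
  have hne : (k : ℝ) ≠ r := by linarith
  rw [Real.norm_of_nonneg (by positivity), logPrimitiveCoeff, if_neg hne, abs_div]
  gcongr
  exact div_le_self (abs_nonneg _) (by rw [abs_of_pos] <;> linarith)

theorem summable_logCoeff (b : ℕ → ℝ) (r : ℝ) :
    Summable fun k : ℕ => if (k : ℝ) = r then b k else 0 := by
  refine summable_of_hasFiniteSupport (Set.Finite.subset (Set.finite_singleton ⌈r⌉₊) fun k hk => ?_)
  have : (k : ℝ) = r := by
    by_contra hne
    simp [hne] at hk
  simp [← this]

theorem hasSum_logPrimitiveSeries (hx0 : 0 < x) (h : Summable fun k => |b k| * x ^ k) :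
    HasSum
      (fun k : ℕ => if (k : ℝ) = r then b k * Real.log x
        else b k * x ^ ((k : ℝ) - r) / ((k : ℝ) - r))
      (x ^ (-r) * (∑' k, logPrimitiveCoeff b r k * x ^ k) +
        (∑' k : ℕ, if (k : ℝ) = r then b k else 0) * Real.log x) := by
  have h1 : Summable fun k => logPrimitiveCoeff b r k * x ^ k :=
    Summable.of_norm ((summable_abs_logPrimitiveCoeff_mul_pow hx0.le h).congr fun k => by
      rw [Real.norm_eq_abs, abs_mul, abs_pow, abs_of_pos hx0])
  refine ((h1.hasSum.mul_left (x ^ (-r))).add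
    ((summable_logCoeff b r).hasSum.mul_right (Real.log x))).congr_fun ?_
  intro k
  by_cases hk : (k : ℝ) = r
  · simp [hk, logPrimitiveCoeff]
  · simp only [hk, logPrimitiveCoeff, if_false]
    rw [sub_eq_add_neg, Real.rpow_add hx0, Real.rpow_natCast]
    ring

theorem analyticAt_logPrimitiveSeries
    (h : ∀ y, 0 ≤ y → y < 1 → Summable fun k => |b k| * y ^ k) (hx0 : 0 < x) (hx1 : x < 1) :
    AnalyticAt ℝ (logPrimitiveSeries b r) x := by
  have hS : AnalyticAt ℝ (fun z => ∑' k, logPrimitiveCoeff b r k * z ^ k) x := by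
    set p := FormalMultilinearSeries.ofScalars ℝ (logPrimitiveCoeff b r) with hp
    obtain ⟨y, hxy, hy1⟩ := exists_between hx1
    have hy0 : 0 < y := hx0.trans hxy
    lift y to NNReal using hy0.le
    have hrad : (y : ENNReal) ≤ p.radius := by
      refine p.le_radius_of_summable
        ((summable_abs_logPrimitiveCoeff_mul_pow (r := r) y.2 (h y y.2 hy1)).congr fun k => ?_)
      simp [hp]
    have hpos : 0 < p.radius := lt_of_lt_of_le (by exact_mod_cast hy0) hrad
    have := (p.hasFPowerSeriesOnBall hpos).analyticAt_of_mem (y := x) <| by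
      refine Metric.eball_subset_eball hrad ?_
      simpa [Metric.mem_eball, edist_dist, Real.dist_eq, abs_of_pos hx0,
        ENNReal.ofReal_lt_coe_iff hx0.le] using hxy
    refine this.congr (Eventually.of_forall fun z => ?_)
    simp [hp, FormalMultilinearSeries.sum, mul_comm]
  have : AnalyticAt ℝ (fun z => z ^ (-r) * (∑' k, logPrimitiveCoeff b r k * z ^ k) +
        (∑' k : ℕ, if (k : ℝ) = r then b k else 0) * Real.log z) x := by
    have h1 : AnalyticAt ℝ (fun z : ℝ => z ^ (-r)) x := analyticAt_id.rpow_const_of_ne hx0.ne' _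
    have h2 : AnalyticAt ℝ Real.log x := analyticAt_log hx0
    exact (h1.mul hS).add (analyticAt_const.mul h2)
  refine this.congr ?_
  filter_upwards [Ioo_mem_nhds hx0 hx1] with z hz
  exact (hasSum_logPrimitiveSeries hz.1 (h z hz.1.le hz.2)).tsum_eq.symm

theorem hasDerivAt_logPrimitiveSeries
    (h : ∀ y, 0 ≤ y → y < 1 → Summable fun k => |b k| * y ^ k) (hx0 : 0 < x) (hx1 : x < 1) :
    HasDerivAt (logPrimitiveSeries b r) (x ^ (-r - 1) * ∑' k, b k * x ^ k) x := by
  obtain ⟨c, hc0, hcx⟩ := exists_between hx0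
  obtain ⟨d, hxd, hd1⟩ := exists_between hx1
  have hd0 : 0 < d := hx0.trans hxd
  rw [← tsum_mul_left]
  refine hasDerivAt_tsum_of_isPreconnected (t := Set.Ioo c d) (y₀ := x)
    (u := fun k => (c ^ (-r - 1) + d ^ (-r - 1)) * (|b k| * d ^ k))
    (g' := fun k z => z ^ (-r - 1) * (b k * z ^ k))
    ((h d hd0.le hd1).mul_left _) isOpen_Ioo isPreconnected_Ioo ?_ ?_ ⟨hcx, hxd⟩
    (hasSum_logPrimitiveSeries hx0 (h x hx0.le hx1)).summable ⟨hcx, hxd⟩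
  · intro k z hz
    have hz0 : 0 < z := hc0.trans hz.1
    have e : z ^ (-r - 1) * (b k * z ^ k) = b k * z ^ ((k : ℝ) - r - 1) := by
      rw [show (k : ℝ) - r - 1 = (-r - 1) + k by ring, Real.rpow_add hz0, Real.rpow_natCast]
      ring
    rw [e]
    by_cases hk : (k : ℝ) = r
    · simp only [hk, if_true, sub_self, zero_sub, Real.rpow_neg_one]
      exact (Real.hasDerivAt_log hz0.ne').const_mul _
    · simp only [hk, if_false]
      have hk' : (k : ℝ) - r ≠ 0 := sub_ne_zero.2 hk
      refine (((Real.hasDerivAt_rpow_const (p := (k : ℝ) - r) (Or.inl hz0.ne')).const_mul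
        (b k)).div_const ((k : ℝ) - r)).congr_deriv ?_
      field_simp
  · intro k z hz
    have hz0 : 0 < z := hc0.trans hz.1
    rw [Real.norm_eq_abs, abs_mul, abs_mul, abs_pow, abs_of_pos hz0,
      abs_of_pos (Real.rpow_pos_of_pos hz0 _)]
    have hle : z ^ (-r - 1) ≤ c ^ (-r - 1) + d ^ (-r - 1) := by
      have hc := Real.rpow_pos_of_pos hc0 (-r - 1)
      have hd := Real.rpow_pos_of_pos hd0 (-r - 1)
      rcases le_total (-r - 1) 0 with hr | hr
      · linarith [Real.rpow_le_rpow_of_nonpos hc0 hz.1.le hr]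
      · linarith [Real.rpow_le_rpow hz0.le hz.2.le hr]
    have hzd := hz.2.le
    gcongr

end LogPrimitiveSeries
section GKPRowPolynomial

open Polynomial

variable {α β γ α' β' γ' : ℝ} {A : ℕ → ℕ → ℝ}

/-- Row generating polynomial of a triangular array. -/
noncomputable def rowPolynomial (A : ℕ → ℕ → ℝ) (n : ℕ) : ℝ[X] :=
  ∑ k ∈ Finset.range (n + 1), C (A n k) * X ^ k

theorem gkp_eq_zero_of_lt (h0k : ∀ k : ℕ, A 0 (k + 1) = 0)
    (hnk : ∀ n k : ℕ, A (n + 1) (k + 1) =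
      (α * (n + 1) + β * (k + 1) + γ) * A n (k + 1)
        + (α' * (n + 1) + β' * (k + 1) + γ') * A n k) {n k : ℕ} (h : n < k) :
    A n k = 0 := by
  induction n generalizing k with
  | zero =>
    obtain ⟨k, rfl⟩ := Nat.exists_eq_add_one_of_ne_zero h.ne'
    exact h0k k
  | succ n ih =>
    obtain ⟨k, rfl⟩ := Nat.exists_eq_add_one_of_ne_zero (Nat.ne_zero_of_lt h)
    rw [hnk, ih (by omega), ih (by omega)]
    ring

theorem coeff_rowPolynomial (hA : ∀ n k, n < k → A n k = 0) (n k : ℕ) :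
    (rowPolynomial A n).coeff k = A n k := by
  simp only [rowPolynomial, finsetSum_coeff, coeff_C_mul_X_pow, Finset.sum_ite_eq,
    Finset.mem_range]
  split_ifs with h
  · rfl
  · exact (hA n k (by omega)).symm

theorem rowPolynomial_succ (h0k : ∀ k : ℕ, A 0 (k + 1) = 0)
    (hn0 : ∀ n : ℕ, A (n + 1) 0 = (α * (n + 1) + γ) * A n 0)
    (hnk : ∀ n k : ℕ, A (n + 1) (k + 1) =
      (α * (n + 1) + β * (k + 1) + γ) * A n (k + 1)
        + (α' * (n + 1) + β' * (k + 1) + γ') * A n k) (n : ℕ) :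
    rowPolynomial A (n + 1) = C (α * (n + 1) + γ) * rowPolynomial A n
      + C β * (derivative (rowPolynomial A n) * X)
      + C (α' * (n + 1) + β' + γ') * (rowPolynomial A n * X)
      + C β' * (derivative (rowPolynomial A n) * X * X) := by
  have hA : ∀ n k, n < k → A n k = 0 := fun n k h => gkp_eq_zero_of_lt h0k hnk h
  ext k
  rcases k with _ | _ | k <;>
  simp only [coeff_add, coeff_C_mul, coeff_mul_X, coeff_mul_X_zero, coeff_derivative,
    coeff_rowPolynomial hA, hn0, hnk] <;> push_cast <;> ring

end GKPRowPolynomial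

theorem tendsto_iteratedDeriv_of_eventuallyEq_punctured {f F : ℝ → ℝ} {x : ℝ}
    (hF : AnalyticAt ℝ F x) (h : f =ᶠ[𝓝[≠] x] F) (n : ℕ) :
    Tendsto (iteratedDeriv n f) (𝓝[≠] x) (𝓝 (iteratedDeriv n F x)) := by
  have hc : ContinuousAt (iteratedDeriv n F) x := by
    rw [iteratedDeriv_eq_iterate]
    exact (hF.iterated_deriv n).continuousAt
  refine (hc.tendsto.mono_left nhdsWithin_le_nhds).congr' ?_
  filter_upwards [eventually_eventually_nhdsWithin.2 h, self_mem_nhdsWithin] with y hy hyx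
  rw [isOpen_compl_singleton.nhdsWithin_eq hyx] at hy
  exact (EventuallyEq.iteratedDeriv_eq n hy).symm

theorem hasDerivAt_rpow_mul_one_add_mul_rpow_mul {p : ℝ → ℝ} {p' σ a e z : ℝ} (hz : 0 < z)
    (hσz : 0 < 1 + σ * z) (hp : HasDerivAt p p' z) :
    HasDerivAt (fun y => y ^ a * (1 + σ * y) ^ e * p y)
      (z ^ (a - 1) * (1 + σ * z) ^ (e - 1) *
        ((a + (a + e) * (σ * z)) * p z + z * (1 + σ * z) * p')) z := by
  have h1 := Real.hasDerivAt_rpow_const (p := a) (Or.inl hz.ne')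
  have h2 : HasDerivAt (fun y => 1 + σ * y) σ z := by
    simpa using ((hasDerivAt_id z).const_mul σ).const_add 1
  have h3 := h2.rpow_const (p := e) (Or.inl hσz.ne')
  refine ((h1.mul h3).mul hp).congr_deriv ?_
  have e1 : z ^ a = z ^ (a - 1) * z := by
    rw [← Real.rpow_add_one hz.ne', sub_add_cancel]
  have e2 : (1 + σ * z) ^ e = (1 + σ * z) ^ (e - 1) * (1 + σ * z) := by
    rw [← Real.rpow_add_one hσz.ne', sub_add_cancel]
  simp only [Pi.mul_apply]
  rw [e1, e2]
  ring

open Real Topology in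
/-- Residue formula for Type I row polynomials: with σ = sign(ββ'), r = α/β, r' = α'/β',
s = (α+γ)/β, s' = −1−(α'+γ')/β', η = s+s'+1+r'−r, Q = G⁻¹_{r,r',σ},
𝒫_n(X) = β^{−n}P_n(σβX/β') and
f(Z) = Z^{s−r−1}(1+σZ)^{−η}((Z−X)/(Q(Z)−Q(X)))^{n+1}, the n-th derivative of f tends to
X^{s+rn}(1+σX)^{−n(r−r')−s−s'}𝒫_n(X) as Z → X, Z ≠ X, for 0 < X < 1. -/
theorem stmt_17 (α β γ α' β' γ' : ℝ) (hββ' : β * β' ≠ 0)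
    (σ r r' s s' η : ℝ)
    (hσ : σ = Real.sign (β * β'))
    (hr : r = α / β) (hr' : r' = α' / β')
    (hs : s = (α + γ) / β) (hs' : s' = -1 - (α' + γ') / β')
    (hη : η = s + s' + 1 + r' - r)
    (A : ℕ → ℕ → ℝ)
    (h00 : A 0 0 = 1)
    (h0k : ∀ k : ℕ, A 0 (k + 1) = 0)
    (hn0 : ∀ n : ℕ, A (n + 1) 0 = (α * (n + 1) + γ) * A n 0)
    (hnk : ∀ n k : ℕ, A (n + 1) (k + 1) =
      (α * (n + 1) + β * (k + 1) + γ) * A n (k + 1)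
        + (α' * (n + 1) + β' * (k + 1) + γ') * A n k)
    (binom : ℝ → ℕ → ℝ)
    (hbinom : ∀ (a : ℝ) (k : ℕ),
      binom a k = (∏ i ∈ Finset.range k, (a - (i : ℝ))) / (k.factorial : ℝ))
    (Q : ℝ → ℝ)
    (hQ : ∀ X : ℝ, Q X = ∑' k : ℕ,
      (if (k : ℝ) = r
        then σ ^ k * binom (r - r' - 1) k * Real.log X
        else σ ^ k * binom (r - r' - 1) k * X ^ ((k : ℝ) - r) / ((k : ℝ) - r)))
    (P : ℕ → ℝ → ℝ)
    (hP : ∀ (m : ℕ) (X : ℝ),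
      P m X = (β ^ m)⁻¹ * ∑ k ∈ Finset.range (m + 1), A m k * (σ * β * X / β') ^ k)
    (X : ℝ) (hX0 : 0 < X) (hX1 : X < 1) (n : ℕ) (f : ℝ → ℝ)
    (hf : ∀ Z : ℝ, f Z = Z ^ (s - r - 1) * (1 + σ * Z) ^ (-η)
        * ((Z - X) / (Q Z - Q X)) ^ (n + 1)) :
    Filter.Tendsto (iteratedDeriv n f) (𝓝[≠] X)
      (𝓝 (X ^ (s + r * n) * (1 + σ * X) ^ (-((n : ℝ) * (r - r')) - s - s') * P n X)) := by
  have hβ : β ≠ 0 := left_ne_zero_of_mul hββ'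
  have hβ' : β' ≠ 0 := right_ne_zero_of_mul hββ'
  have hσ1 : |σ| = 1 := by
    rcases lt_or_gt_of_ne hββ' with h | h
    · rw [hσ, Real.sign_of_neg h]; simp
    · rw [hσ, Real.sign_of_pos h]; simp
  have hσpos : ∀ z, 0 < z → z < 1 → 0 < 1 + σ * z := fun z h0 h1 => by
    nlinarith [neg_abs_le σ]
  set a := r - r' - 1 with ha
  set b : ℕ → ℝ := fun k => σ ^ k * binom a k with hb
  have hbc : ∀ k, binom a k = Ring.choose a k := fun k => by
    rw [hbinom, Ring.choose_eq_prod_range_div_factorial]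
  have hbs : ∀ y, 0 ≤ y → y < 1 → Summable fun k => |b k| * y ^ k := fun y h0 h1 => by
    refine (summable_abs_choose_mul_pow a h0 h1).congr fun k => ?_
    rw [hb]
    simp only [abs_mul, abs_pow, hσ1, one_pow, one_mul, hbc]
  have hbsum : ∀ z, 0 < z → z < 1 → ∑' k, b k * z ^ k = (1 + σ * z) ^ a := fun z h0 h1 => by
    have h := hasSum_choose_mul_pow a (x := σ * z) (by rwa [abs_mul, hσ1, one_mul, abs_of_pos h0])
    rw [← h.tsum_eq]
    refine tsum_congr fun k => ?_
    simp only [hb, hbc, mul_pow]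
    ring
  have hQs : Q = logPrimitiveSeries b r := funext fun z => hQ z
  have hQan : AnalyticAt ℝ Q X := hQs ▸ analyticAt_logPrimitiveSeries hbs hX0 hX1
  have hQd : ∀ z, 0 < z → z < 1 → deriv Q z = z ^ (-r - 1) * (1 + σ * z) ^ a :=
    fun z h0 h1 => by
      rw [hQs, (hasDerivAt_logPrimitiveSeries hbs h0 h1).deriv, hbsum z h0 h1]
  have hQne : deriv Q X ≠ 0 := by
    rw [hQd X hX0 hX1]
    exact (mul_pos (Real.rpow_pos_of_pos hX0 _) (Real.rpow_pos_of_pos (hσpos X hX0 hX1) _)).ne'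
  have hPp : ∀ m, P m = fun z => (β ^ m)⁻¹ * (rowPolynomial A m).eval (σ * β * z / β') :=
    fun m => funext fun z => by
      simp [hP, rowPolynomial, Polynomial.eval_finsetSum]
  have hPd : ∀ m z, HasDerivAt (P m) ((β ^ m)⁻¹ *
      ((rowPolynomial A m).derivative.eval (σ * β * z / β') * (σ * β / β'))) z := fun m z => by
    rw [hPp]
    have h1 : HasDerivAt (fun z => σ * β * z / β') (σ * β / β') z := by
      simpa using ((hasDerivAt_id z).const_mul (σ * β)).div_const β'
    exact (((rowPolynomial A m).hasDerivAt _).comp z h1).const_mul _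
  set T : ℕ → ℝ → ℝ := fun m z =>
    z ^ (s + r * m) * (1 + σ * z) ^ (-((m : ℝ) * (r - r')) - s - s') * P m z with hT
  have hTan : ∀ m, AnalyticAt ℝ (T m) X := fun m => by
    have h1 : AnalyticAt ℝ (fun z => (1 + σ * z) ^ (-((m : ℝ) * (r - r')) - s - s')) X :=
      AnalyticAt.rpow_const_of_ne (f := fun z => 1 + σ * z) (by fun_prop) (hσpos X hX0 hX1).ne' _
    have h2 : AnalyticAt ℝ (P m) X := by
      have : P m = fun z => (β ^ m)⁻¹ *
          ∑ k ∈ Finset.range (m + 1), A m k * (σ * β * z / β') ^ k := funext fun z => hP m z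
      rw [this]
      fun_prop
    exact ((analyticAt_id.rpow_const_of_ne hX0.ne' _).mul h1).mul h2
  have hTrec : ∀ m, deriv (T m) =ᶠ[𝓝 X] fun z => T (m + 1) z * deriv Q z := fun m => by
    filter_upwards [Ioo_mem_nhds hX0 hX1] with z hz
    have hz1 := hσpos z hz.1 hz.2
    rw [hQd z hz.1 hz.2,
      (hasDerivAt_rpow_mul_one_add_mul_rpow_mul hz.1 hz1 (hPd m z)).deriv]
    have e1 : z ^ (s + r * m - 1) = z ^ (s + r * (m + 1 : ℕ)) * z ^ (-r - 1) := by
      rw [← Real.rpow_add hz.1]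
      congr 1; push_cast; ring
    have e2 : (1 + σ * z) ^ (-((m : ℝ) * (r - r')) - s - s' - 1) =
        (1 + σ * z) ^ (-(((m + 1 : ℕ) : ℝ) * (r - r')) - s - s') * (1 + σ * z) ^ a := by
      rw [← Real.rpow_add hz1]
      congr 1; push_cast; ring
    have e3 : P (m + 1) z = (s + r * m + (s + r * m + (-((m : ℝ) * (r - r')) - s - s')) * (σ * z))
        * P m z + z * (1 + σ * z) * ((β ^ m)⁻¹ *
          ((rowPolynomial A m).derivative.eval (σ * β * z / β') * (σ * β / β'))) := by
      simp only [hPp, rowPolynomial_succ h0k hn0 hnk, Polynomial.eval_add, Polynomial.eval_mul,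
        Polynomial.eval_C, Polynomial.eval_X]
      generalize Polynomial.eval _ (rowPolynomial A m) = u
      generalize Polynomial.eval _ (Polynomial.derivative (rowPolynomial A m)) = v
      rw [hs, hs', hr, hr', pow_succ]
      field_simp
      ring
    rw [e1, e2, ← e3]
    simp only [hT]
    ring
  have hLag := iteratedDeriv_mul_deriv_div_dslope_pow hQan hQne hTan hTrec n 0
  rw [zero_add] at hLag
  have hD : dslope Q X X ≠ 0 := by rwa [dslope_same]
  have hFan : AnalyticAt ℝ (fun z => T 0 z * deriv Q z * (dslope Q X z)⁻¹ ^ (n + 1)) X :=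
    ((hTan 0).mul hQan.deriv).mul ((hQan.dslope_self.inv hD).pow _)
  have hlim := tendsto_iteratedDeriv_of_eventuallyEq_punctured (f := f) hFan ?_ n
  · rwa [hLag] at hlim
  · filter_upwards [nhdsWithin_le_nhds (Ioo_mem_nhds hX0 hX1), self_mem_nhdsWithin] with z hz hzX
    have hz1 := hσpos z hz.1 hz.2
    have hP0 : P 0 z = 1 := by simp [hP, h00]
    have e1 : z ^ (s - r - 1) = z ^ (s + r * (0 : ℕ)) * z ^ (-r - 1) := by
      rw [← Real.rpow_add hz.1]
      congr 1; push_cast; ring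
    have e2 : (1 + σ * z) ^ (-η) =
        (1 + σ * z) ^ (-(((0 : ℕ) : ℝ) * (r - r')) - s - s') * (1 + σ * z) ^ a := by
      rw [← Real.rpow_add hz1, hη]
      congr 1; push_cast; ring
    rw [hf, hQd z hz.1 hz.2, dslope_of_ne _ hzX, slope_def_field, inv_div, e1, e2]
    simp only [hT, hP0]
    ring
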